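/- The two A-excircle CCP solution triangles share their symmedian point, which is the A-exversion of the Gergonne point of the reference triangle: the symmedian point of the triangle (P1,P2,P3) and the symmedian point of the triangle (Q1,Q2,Q3) both equal the point with barycentric coordinates [(b−s)(c−s) : (b−s)s : (c−s)s] with respect to (A,B,C). -/

import Mathlib

open EuclideanGeometry

/-- The point with barycentric coordinates `[x : y : z]` with respect to `(A, B, C)`. -/
noncomputable def bary (A B C : EuclideanSpace ℝ (Fin 2)) (x y z : ℝ) :
    EuclideanSpace ℝ (Fin 2) :=
  (x + y + z)⁻¹ • (x • A + y • B + z • C)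

section Barycentric

variable (A B C : EuclideanSpace ℝ (Fin 2))

theorem bary_mul {k : ℝ} (hk : k ≠ 0) (x y z : ℝ) :
    bary A B C (k * x) (k * y) (k * z) = bary A B C x y z := by
  simp only [bary, mul_smul, ← smul_add, ← mul_add, mul_inv]
  rw [smul_smul, smul_smul, mul_right_comm, inv_mul_cancel₀ hk, one_mul]

theorem sum_smul_bary {x y z : ℝ} (h : x + y + z ≠ 0) :
    (x + y + z) • bary A B C x y z = x • A + y • B + z • C := by
  rw [bary, smul_inv_smul₀ h]

theorem bary_eq_add {x y z : ℝ} (h : x + y + z ≠ 0) :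
    bary A B C x y z =
      A + (y / (x + y + z)) • (B - A) + (z / (x + y + z)) • (C - A) := by
  apply smul_right_injective _ h
  simp only [sum_smul_bary A B C h, smul_add, smul_smul, mul_div_cancel₀ _ h]
  module

theorem dist_sq_bary {x y z x' y' z' : ℝ} (h : x + y + z ≠ 0) (h' : x' + y' + z' ≠ 0) :
    dist (bary A B C x y z) (bary A B C x' y' z') ^ 2 =
      (y / (x + y + z) - y' / (x' + y' + z')) ^ 2 * dist A B ^ 2 +
      (z / (x + y + z) - z' / (x' + y' + z')) ^ 2 * dist C A ^ 2 +
      (y / (x + y + z) - y' / (x' + y' + z')) * (z / (x + y + z) - z' / (x' + y' + z')) *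
        (dist C A ^ 2 + dist A B ^ 2 - dist B C ^ 2) := by
  rw [bary_eq_add A B C h, bary_eq_add A B C h']
  generalize y / (x + y + z) = p
  generalize z / (x + y + z) = q
  generalize y' / (x' + y' + z') = p'
  generalize z' / (x' + y' + z') = q'
  have hBC : dist B C ^ 2 = ‖B - A‖ ^ 2 - 2 * inner ℝ (B - A) (C - A) + ‖C - A‖ ^ 2 := by
    rw [dist_eq_norm, ← sub_sub_sub_cancel_right B C A, norm_sub_sq_real]
  have hsub : A + p • (B - A) + q • (C - A) - (A + p' • (B - A) + q' • (C - A)) =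
      (p - p') • (B - A) + (q - q') • (C - A) := by module
  rw [hBC, dist_comm A B, dist_eq_norm, dist_eq_norm, dist_eq_norm, hsub, norm_add_sq_real,
    norm_smul, norm_smul, real_inner_smul_left, real_inner_smul_right, mul_pow, mul_pow,
    Real.norm_eq_abs, Real.norm_eq_abs, sq_abs, sq_abs]
  ring

/-- If the squared side lengths of a triangle are inversely proportional to the products of the
total weights of their endpoints, then the symmedian point has the summed weights. -/
theorem symmedian_eq_bary_sum {x₁ y₁ z₁ x₂ y₂ z₂ x₃ y₃ z₃ K : ℝ}
    {P₁ P₂ P₃ : EuclideanSpace ℝ (Fin 2)}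
    (hP₁ : P₁ = bary A B C x₁ y₁ z₁) (hP₂ : P₂ = bary A B C x₂ y₂ z₂)
    (hP₃ : P₃ = bary A B C x₃ y₃ z₃)
    (h₁ : x₁ + y₁ + z₁ ≠ 0) (h₂ : x₂ + y₂ + z₂ ≠ 0) (h₃ : x₃ + y₃ + z₃ ≠ 0) (hK : K ≠ 0)
    (h₂₃ : dist P₂ P₃ ^ 2 = K / ((x₂ + y₂ + z₂) * (x₃ + y₃ + z₃)))
    (h₃₁ : dist P₃ P₁ ^ 2 = K / ((x₃ + y₃ + z₃) * (x₁ + y₁ + z₁)))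
    (h₁₂ : dist P₁ P₂ ^ 2 = K / ((x₁ + y₁ + z₁) * (x₂ + y₂ + z₂))) :
    bary P₁ P₂ P₃ (dist P₂ P₃ ^ 2) (dist P₃ P₁ ^ 2) (dist P₁ P₂ ^ 2) =
      bary A B C (x₁ + x₂ + x₃) (y₁ + y₂ + y₃) (z₁ + z₂ + z₃) := by
  set k := K / ((x₁ + y₁ + z₁) * (x₂ + y₂ + z₂) * (x₃ + y₃ + z₃)) with hk
  have hk0 : k ≠ 0 := by positivity
  have e₁ : dist P₂ P₃ ^ 2 = k * (x₁ + y₁ + z₁) := by rw [h₂₃, hk]; field_simp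
  have e₂ : dist P₃ P₁ ^ 2 = k * (x₂ + y₂ + z₂) := by rw [h₃₁, hk]; field_simp
  have e₃ : dist P₁ P₂ ^ 2 = k * (x₃ + y₃ + z₃) := by rw [h₁₂, hk]; field_simp
  rw [e₁, e₂, e₃, bary_mul _ _ _ hk0, hP₁, hP₂, hP₃, bary, sum_smul_bary A B C h₁,
    sum_smul_bary A B C h₂, sum_smul_bary A B C h₃, bary]
  congr 1
  · congr 1
    ring
  · module

end Barycentric

section Excircle

variable {A B C : EuclideanSpace ℝ (Fin 2)} {s v w : ℝ}

/-- The point of the `A`-excircle with parameter `(y, z)`, where `s` is the semiperimeter,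
`v = s - b` and `w = s - c`. -/
noncomputable def excirclePoint (A B C : EuclideanSpace ℝ (Fin 2)) (s v w y z : ℝ) :
    EuclideanSpace ℝ (Fin 2) :=
  bary A B C (-(v * w) * (y + z) ^ 2) (s * v * y ^ 2) (s * w * z ^ 2)

theorem excircle_weight_pos (hv : 0 < v) (hw : 0 < w) (hs : v + w < s) {y z : ℝ}
    (h : y ≠ 0) : 0 < -(v * w) * (y + z) ^ 2 + s * v * y ^ 2 + s * w * z ^ 2 := by
  have hy : 0 < (s - v - w) * (v * y ^ 2 + w * z ^ 2) :=
    mul_pos (by linarith) (by positivity)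
  linarith [sq_nonneg (v * y - w * z)]

theorem dist_sq_excirclePoint (hv : 0 < v) (hw : 0 < w) (hs : v + w < s)
    (ha : dist B C = v + w) (hb : dist C A = s - v) (hc : dist A B = s - w)
    {y z y' z' : ℝ} (h : y ≠ 0) (h' : y' ≠ 0) :
    dist (excirclePoint A B C s v w y z) (excirclePoint A B C s v w y' z') ^ 2 =
      (2 * s * v * w * (y * z' - y' * z)) ^ 2 /
      ((-(v * w) * (y + z) ^ 2 + s * v * y ^ 2 + s * w * z ^ 2) *
        (-(v * w) * (y' + z') ^ 2 + s * v * y' ^ 2 + s * w * z' ^ 2)) := by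
  have hD := (excircle_weight_pos hv hw hs h (z := z)).ne'
  have hD' := (excircle_weight_pos hv hw hs h' (z := z')).ne'
  rw [excirclePoint, excirclePoint, dist_sq_bary A B C hD hD', ha, hb, hc,
    div_sub_div _ _ hD hD', div_sub_div _ _ hD hD']
  set D := -(v * w) * (y + z) ^ 2 + s * v * y ^ 2 + s * w * z ^ 2 with hDdef
  set D' := -(v * w) * (y' + z') ^ 2 + s * v * y' ^ 2 + s * w * z' ^ 2 with hDdef'
  have e₁ : s * v * y ^ 2 * D' - D * (s * v * y' ^ 2) =
      s * v * w * (y * z' - y' * z) * ((s - v) * (y * z' + y' * z) - 2 * v * y * y') := by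
    rw [hDdef, hDdef']; ring
  have e₂ : s * w * z ^ 2 * D' - D * (s * w * z' ^ 2) =
      -(s * v * w * (y * z' - y' * z)) *
        ((s - w) * (y * z' + y' * z) - 2 * w * z * z') := by
    rw [hDdef, hDdef']; ring
  have key : ((s - v) * (y * z' + y' * z) - 2 * v * y * y') ^ 2 * (s - w) ^ 2 +
      ((s - w) * (y * z' + y' * z) - 2 * w * z * z') ^ 2 * (s - v) ^ 2 -
      ((s - v) * (y * z' + y' * z) - 2 * v * y * y') *
        ((s - w) * (y * z' + y' * z) - 2 * w * z * z') *
        ((s - v) ^ 2 + (s - w) ^ 2 - (v + w) ^ 2) = 4 * (D * D') := by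
    rw [hDdef, hDdef']; ring
  rw [e₁, e₂, eq_div_iff (mul_ne_zero hD hD')]
  clear_value D D'
  have hinv_sq : (D * D') ^ 2 * (D * D')⁻¹ ^ 2 = 1 := by
    rw [← mul_pow, mul_inv_cancel₀ (mul_ne_zero hD hD'), one_pow]
  simp only [div_eq_mul_inv]
  generalize (D * D')⁻¹ = r at hinv_sq
  linear_combination (s * v * w * (y * z' - y' * z)) ^ 2 * r ^ 2 * (D * D') * key +
    4 * (s * v * w * (y * z' - y' * z)) ^ 2 * hinv_sq

theorem symmedian_excirclePoint (hv : 0 < v) (hw : 0 < w) (hs : v + w < s)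
    (ha : dist B C = v + w) (hb : dist C A = s - v) (hc : dist A B = s - w)
    {y₁ z₁ y₂ z₂ y₃ z₃ δ : ℝ} {P₁ P₂ P₃ : EuclideanSpace ℝ (Fin 2)}
    (hP₁ : P₁ = excirclePoint A B C s v w y₁ z₁) (hP₂ : P₂ = excirclePoint A B C s v w y₂ z₂)
    (hP₃ : P₃ = excirclePoint A B C s v w y₃ z₃)
    (h₁ : y₁ ≠ 0) (h₂ : y₂ ≠ 0) (h₃ : y₃ ≠ 0) (hδ : δ ≠ 0)
    (h₂₃ : y₂ * z₃ - y₃ * z₂ = δ) (h₃₁ : y₃ * z₁ - y₁ * z₃ = δ)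
    (h₁₂ : y₁ * z₂ - y₂ * z₁ = δ) :
    bary P₁ P₂ P₃ (dist P₂ P₃ ^ 2) (dist P₃ P₁ ^ 2) (dist P₁ P₂ ^ 2) =
      bary A B C (-(v * w) * ((y₁ + z₁) ^ 2 + (y₂ + z₂) ^ 2 + (y₃ + z₃) ^ 2))
        (s * v * (y₁ ^ 2 + y₂ ^ 2 + y₃ ^ 2)) (s * w * (z₁ ^ 2 + z₂ ^ 2 + z₃ ^ 2)) := by
  have hs0 : 0 < s := by linarith
  simp only [mul_add (-(v * w)), mul_add (s * v), mul_add (s * w)]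
  apply symmedian_eq_bary_sum A B C (K := (2 * s * v * w * δ) ^ 2) hP₁ hP₂ hP₃
    (excircle_weight_pos hv hw hs h₁).ne' (excircle_weight_pos hv hw hs h₂).ne'
    (excircle_weight_pos hv hw hs h₃).ne' (by positivity)
  · rw [hP₂, hP₃, dist_sq_excirclePoint hv hw hs ha hb hc h₂ h₃, h₂₃]
  · rw [hP₃, hP₁, dist_sq_excirclePoint hv hw hs ha hb hc h₃ h₁, h₃₁]
  · rw [hP₁, hP₂, dist_sq_excirclePoint hv hw hs ha hb hc h₁ h₂, h₁₂]

end Excircle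

theorem AffineIndependent.dist_lt_dist_add_dist {A B C : EuclideanSpace ℝ (Fin 2)}
    (h : AffineIndependent ℝ ![A, B, C]) : dist A C < dist A B + dist B C := by
  refine (dist_triangle A B C).lt_of_ne fun heq => ?_
  rw [affineIndependent_iff_not_collinear_set] at h
  exact h (dist_add_dist_eq_iff.1 heq.symm).collinear

/-- The two A-excircle CCP solution triangles share their symmedian point, which is the
A-exversion of the Gergonne point of the reference triangle, with barycentric coordinates
`[(b−s)(c−s) : (b−s)s : (c−s)s]` with respect to `(A, B, C)`. -/
theorem ccp_a_excircle_solutions_symmedian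
    (A B C : EuclideanSpace ℝ (Fin 2)) (hABC : AffineIndependent ℝ ![A, B, C])
    (a b c s φ : ℝ)
    (ha : a = dist B C) (hb : b = dist C A) (hc : c = dist A B)
    (hs : s = (a + b + c) / 2)
    (hφ : φ = (1 + Real.sqrt 5) / 2)
    (P1 P2 P3 : EuclideanSpace ℝ (Fin 2))
    (hP1 : P1 = bary A B C ((c - s) * (s - b) * (φ - 1) ^ 2) (s * (s - b))
      (s * (s - c) * (φ - 2) ^ 2))
    (hP2 : P2 = bary A B C ((c - s) * (s - b) * (φ - 2) ^ 2) (s * (s - b) * (φ - 1) ^ 2)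
      (s * (s - c)))
    (hP3 : P3 = bary A B C ((b - s) * (s - c)) (s * (s - b) * (φ - 2) ^ 2)
      (s * (s - c) * (φ - 1) ^ 2))
    (Q1 Q2 Q3 : EuclideanSpace ℝ (Fin 2))
    (hQ1 : Q1 = bary A B C ((b - s) * (s - c) * (φ - 1) ^ 2) (s * (s - b) * (φ - 2) ^ 2)
      (s * (s - c)))
    (hQ2 : Q2 = bary A B C ((c - s) * (s - b)) (s * (s - b) * (φ - 1) ^ 2)
      (s * (s - c) * (φ - 2) ^ 2))
    (hQ3 : Q3 = bary A B C ((b - s) * (s - c) * (φ - 2) ^ 2) (s * (s - b))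
      (s * (s - c) * (φ - 1) ^ 2)) :
    bary P1 P2 P3 ((dist P2 P3) ^ 2) ((dist P3 P1) ^ 2) ((dist P1 P2) ^ 2) =
      bary A B C ((b - s) * (c - s)) ((b - s) * s) ((c - s) * s) ∧
    bary Q1 Q2 Q3 ((dist Q2 Q3) ^ 2) ((dist Q3 Q1) ^ 2) ((dist Q1 Q2) ^ 2) =
      bary A B C ((b - s) * (c - s)) ((b - s) * s) ((c - s) * s) := by
  have hac : dist A C < dist A B + dist B C := hABC.dist_lt_dist_add_dist
  have hab : dist A B < dist A C + dist C B :=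
    AffineIndependent.dist_lt_dist_add_dist (hABC.comm_right)
  have hbc : dist B C < dist B A + dist A C :=
    AffineIndependent.dist_lt_dist_add_dist (hABC.comm_left)
  rw [dist_comm A C, ← ha, ← hb, ← hc] at hac
  rw [dist_comm A C, dist_comm C B, ← ha, ← hb, ← hc] at hab
  rw [dist_comm A C, dist_comm B A, ← ha, ← hb, ← hc] at hbc
  have hv : 0 < s - b := by linarith
  have hw : 0 < s - c := by linarith
  have hvw : s - b + (s - c) < s := by linarith
  have ha' : dist B C = s - b + (s - c) := by linarith
  have hb' : dist C A = s - (s - b) := by linarith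
  have hc' : dist A B = s - (s - c) := by linarith
  have hsqrt : Real.sqrt 5 ^ 2 = 5 := Real.sq_sqrt (by norm_num)
  have hφ2 : φ ^ 2 = φ + 1 := by rw [hφ]; linear_combination hsqrt / 4
  have h1 : φ - 1 ≠ 0 := fun h => by
    rw [show φ = 1 by linarith] at hφ2; norm_num at hφ2
  have h2 : φ - 2 ≠ 0 := fun h => by
    rw [show φ = 2 by linarith] at hφ2; norm_num at hφ2
  have h1' : 1 - φ ≠ 0 := fun h => h1 (by linarith)
  have hδ : 2 * (2 - φ) ≠ 0 := fun h => h2 (by linarith)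
  have hk : -(8 - 4 * φ) ≠ 0 := fun h => h2 (by linarith)
  rw [← bary_mul A B C hk ((b - s) * (c - s))]
  constructor
  · rw [symmedian_excirclePoint hv hw hvw ha' hb' hc'
      (y₁ := -1) (z₁ := 2 - φ) (y₂ := φ - 1) (z₂ := -1) (y₃ := 2 - φ) (z₃ := φ - 1)
      (by rw [hP1, excirclePoint]; congr 1 <;> ring)
      (by rw [hP2, excirclePoint]; congr 1 <;> ring)
      (by rw [hP3, excirclePoint]; congr 1 <;> ring)
      (by norm_num) h1 (sub_ne_zero.2 (sub_ne_zero.1 h2).symm) hδ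
      (by linear_combination hφ2) (by linear_combination hφ2) (by linear_combination hφ2)]
    congr 1
    · linear_combination -(s - b) * (s - c) * 2 * hφ2
    · linear_combination s * (s - b) * 2 * hφ2
    · linear_combination s * (s - c) * 2 * hφ2
  · rw [symmedian_excirclePoint hv hw hvw ha' hb' hc'
      (y₁ := φ - 2) (z₁ := 1) (y₂ := 1 - φ) (z₂ := φ - 2) (y₃ := 1) (z₃ := 1 - φ)
      (by rw [hQ1, excirclePoint]; congr 1 <;> ring)
      (by rw [hQ2, excirclePoint]; congr 1 <;> ring)
      (by rw [hQ3, excirclePoint]; congr 1 <;> ring)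
      h2 h1' one_ne_zero hδ
      (by linear_combination hφ2) (by linear_combination hφ2) (by linear_combination hφ2)]
    congr 1
    · linear_combination -(s - b) * (s - c) * 2 * hφ2
    · linear_combination s * (s - b) * 2 * hφ2
    · linear_combination s * (s - c) * 2 * hφ2
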